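/- (Pure translation gains the full rotation group as unobservable.) Let g, P₁, V₁, P_k, P_f ∈ ℝ³, δt ∈ ℝ, let R₁ be a rotation matrix, let Γ₂, Γ_{l2}, A ∈ ℝ³ˣ³ be arbitrary, let (n_L, v_L) be Plücker line coordinates (nonzero, n_Lᵀv_L = 0), and let n be a unit vector, d ≠ 0, Π = d·n. Substitute the pure-translation state-transition block Φ₅₄ = −½δt²R₁, i.e., set Γ₄ = ½δt²R₁ in the point block row, Γ_{l3} = −½δt²⌊v_L×⌋R₁ in the line block row, and Γ_{π3} = ½δt²nnᵀR₁ in the plane block row. Define N_R by the stacked 3×3 blocks: orientation R₁ᵀ, gyro bias 0, velocity −⌊V₁×⌋, accel bias −R₁ᵀ⌊g×⌋, position −⌊P₁×⌋, point feature −⌊P_f×⌋, line blocks (−I₃; 0₁ₓ₃), plane block −⌊Π×⌋ (restricting to the relevant feature blocks in each case). Then: (i) [Γ₁, Γ₂, −δtI₃, ½δt²R₁, −I₃, I₃]·N_R(point) = 0 with Γ₁ = ⌊(P_f − P₁ − V₁δt + ½δt²g)×⌋R₁; (ii) [Γ_{l1}, Γ_{l2}, δt⌊v_L×⌋, −½δt²⌊v_L×⌋R₁,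 ⌊v_L×⌋, Γ_{l4}, Γ_{l5}]·N_R(line) = 0; (iii) [Γ_{π1}, A, −δt·nnᵀ, ½δt²nnᵀR₁, −nnᵀ, Γ_{π4}]·N_R(plane) = 0. Hence under pure translational motion the entire 3-dimensional global rotation (not just yaw) becomes unobservable for the aided INS with point, line and plane features. -/

import Mathlib

open Matrix

noncomputable section

abbrev V3 : Type := Fin 3 → ℝ
abbrev M3 : Type := Matrix (Fin 3) (Fin 3) ℝ

/-- The skew-symmetric cross-product matrix `⌊v×⌋`. -/
def skew (v : V3) : M3 :=
  !![0, -(v 2), v 1; v 2, 0, -(v 0); -(v 1), v 0, 0]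

/-- `R` is a rotation matrix: `RᵀR = I₃` and `det R = 1`. -/
def IsRot (R : M3) : Prop := Rᵀ * R = 1 ∧ R.det = 1

/-- Euclidean norm on `ℝ³`. -/
def norm3 (v : V3) : ℝ := Real.sqrt (v ⬝ᵥ v)

def e1 : V3 := ![1, 0, 0]
def e2 : V3 := ![0, 1, 0]
def e3 : V3 := ![0, 0, 1]

/-- The 3×3 matrix with the given columns. -/
def cols3 (a b c : V3) : M3 := Matrix.of fun i j => ![a i, b i, c i] j

/-- The 3×3 matrix with the given rows. -/
def rows3 (a b c : V3) : M3 := Matrix.of ![a, b, c]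

/-- 18-dimensional aided-INS state index:
(orientation, gyro bias, velocity, accel bias, position, feature). -/
abbrev S18 : Type := Fin 3 ⊕ Fin 3 ⊕ Fin 3 ⊕ Fin 3 ⊕ Fin 3 ⊕ Fin 3

/-- The 3×18 block row `[A B C D E F]`. -/
def row6 (A B C D E F : M3) : Matrix (Fin 3) S18 ℝ :=
  Matrix.of fun i =>
    Sum.elim (fun j => A i j) (Sum.elim (fun j => B i j) (Sum.elim (fun j => C i j)
      (Sum.elim (fun j => D i j) (Sum.elim (fun j => E i j) (fun j => F i j)))))

/-- The stacked vector `(a; b; c; d; e; f)` in ℝ¹⁸. -/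
def col6 (a b c d e f : V3) : S18 → ℝ :=
  Sum.elim a (Sum.elim b (Sum.elim c (Sum.elim d (Sum.elim e f))))

/-- The 18×3 stacked blocks `(A; B; C; D; E; F)`. -/
def stack6 (A B C D E F : M3) : Matrix S18 (Fin 3) ℝ :=
  Matrix.of (Sum.elim (fun i => A i) (Sum.elim (fun i => B i) (Sum.elim (fun i => C i)
    (Sum.elim (fun i => D i) (Sum.elim (fun i => E i) (fun i => F i))))))

/-- 19-dimensional state index:
(orientation, gyro bias, velocity, accel bias, position, δθ_L, δφ_L). -/
abbrev S19 : Type := Fin 3 ⊕ Fin 3 ⊕ Fin 3 ⊕ Fin 3 ⊕ Fin 3 ⊕ Fin 3 ⊕ Fin 1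

/-- The 3×19 block row `[A B C D E F w]` (last block a column vector). -/
def row6v (A B C D E F : M3) (w : V3) : Matrix (Fin 3) S19 ℝ :=
  Matrix.of fun i =>
    Sum.elim (fun j => A i j) (Sum.elim (fun j => B i j) (Sum.elim (fun j => C i j)
      (Sum.elim (fun j => D i j) (Sum.elim (fun j => E i j)
        (Sum.elim (fun j => F i j) (fun _ => w i))))))

/-- The stacked vector `(a; b; c; d; e; f; s)` in ℝ¹⁹. -/
def col7 (a b c d e f : V3) (s : ℝ) : S19 → ℝ :=
  Sum.elim a (Sum.elim b (Sum.elim c (Sum.elim d (Sum.elim e (Sum.elim f (fun _ => s))))))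

/-- The 19×3 stacked blocks `(A; B; C; D; E; F; r)` (last block a row vector). -/
def stack7 (A B C D E F : M3) (r : V3) : Matrix S19 (Fin 3) ℝ :=
  Matrix.of (Sum.elim (fun i => A i) (Sum.elim (fun i => B i) (Sum.elim (fun i => C i)
    (Sum.elim (fun i => D i) (Sum.elim (fun i => E i)
      (Sum.elim (fun i => F i) (fun _ => r)))))))


theorem skew_add (u v : V3) : skew (u + v) = skew u + skew v := by
  ext i j
  fin_cases i <;> fin_cases j <;> simp [skew] <;> ring

theorem skew_smul (c : ℝ) (v : V3) : skew (c • v) = c • skew v := by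
  ext i j
  fin_cases i <;> fin_cases j <;> simp [skew]

theorem skew_sub (u v : V3) : skew (u - v) = skew u - skew v := by
  rw [sub_eq_add_neg, ← neg_one_smul ℝ v, skew_add, skew_smul, neg_one_smul, sub_eq_add_neg]

theorem skew_mulVec (u v : V3) : skew (skew u *ᵥ v) = skew u * skew v - skew v * skew u := by
  ext i j
  fin_cases i <;> fin_cases j <;>
    simp [skew, Matrix.mulVec, dotProduct, Fin.sum_univ_three, vecHead, vecTail] <;> ring

theorem vecMul_skew_swap (u v : V3) : u ᵥ* skew v = -(v ᵥ* skew u) := by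
  ext j
  fin_cases j <;> simp [skew, Matrix.vecMul, dotProduct, Fin.sum_univ_three, vecHead, vecTail] <;> ring

theorem vecMul_skew_self (v : V3) : v ᵥ* skew v = 0 :=
  self_eq_neg.mp (vecMul_skew_swap v v)

theorem row6_mul_stack6 (A B C D E F A' B' C' D' E' F' : M3) :
    row6 A B C D E F * stack6 A' B' C' D' E' F' =
      A * A' + B * B' + C * C' + D * D' + E * E' + F * F' := by
  ext i j
  simp [row6, stack6, Matrix.mul_apply, Fintype.sum_sum_type, add_assoc]

theorem row6v_mul_stack7 (A B C D E F A' B' C' D' E' F' : M3) (w r : V3) :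
    row6v A B C D E F w * stack7 A' B' C' D' E' F' r =
      A * A' + B * B' + C * C' + D * D' + E * E' + F * F' + vecMulVec w r := by
  ext i j
  simp [row6v, stack7, Matrix.mul_apply, Fintype.sum_sum_type, vecMulVec_apply, add_assoc]

/-- under pure translation (Φ₅₄ = −½δt²R₁), the full 3-dimensional
global rotation becomes unobservable for aided INS with point, line and plane
features. -/
theorem pure_translation_rotation_unobservable
    (nL vL n g Pf P₁ V₁ Pk : V3) (d δt : ℝ) (R₁ : M3) (hR₁ : IsRot R₁)
    (hnL : nL ≠ 0) (hvL : vL ≠ 0) (horth : nL ⬝ᵥ vL = 0)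
    (hn : norm3 n = 1) (hd : d ≠ 0)
    (Γ₂ Γl2 A : M3) :
    let w₁ : ℝ := norm3 nL
    let w₂ : ℝ := norm3 vL
    let cp : V3 := d • n
    let Γ₁ : M3 := skew (Pf - P₁ - δt • V₁ + (δt ^ 2 / 2) • g) * R₁
    let Γl1 : M3 := (skew nL - skew (skew Pk *ᵥ vL) + skew vL * skew P₁
        + δt • (skew vL * skew V₁) - (δt ^ 2 / 2) • (skew vL * skew g)
        - skew vL * skew Pk) * R₁
    let Γl4 : M3 := skew nL - skew Pk * skew vL
    let Γl5 : V3 := -((w₂ / w₁) • nL + (w₁ / w₂) • (skew Pk *ᵥ vL))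
    let Γπ1 : M3 := ((d - n ⬝ᵥ Pk) • skew n
        - vecMulVec n n * skew (P₁ + δt • V₁ - (δt ^ 2 / 2) • g - Pk)) * R₁
    let Γπ4 : M3 := d⁻¹ • ((d - n ⬝ᵥ Pk) • (1 : M3) - vecMulVec n Pk
        + (2 * (n ⬝ᵥ Pk)) • vecMulVec n n)
    let NRpt : Matrix S18 (Fin 3) ℝ :=
      stack6 R₁ᵀ 0 (-(skew V₁)) (-(R₁ᵀ * skew g)) (-(skew P₁)) (-(skew Pf))
    let NRl : Matrix S19 (Fin 3) ℝ :=
      stack7 R₁ᵀ 0 (-(skew V₁)) (-(R₁ᵀ * skew g)) (-(skew P₁)) (-1) 0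
    let NRπ : Matrix S18 (Fin 3) ℝ :=
      stack6 R₁ᵀ 0 (-(skew V₁)) (-(R₁ᵀ * skew g)) (-(skew P₁)) (-(skew cp))
    row6 Γ₁ Γ₂ ((-δt) • (1 : M3)) ((δt ^ 2 / 2) • R₁) (-1) 1 * NRpt = 0 ∧
    row6v Γl1 Γl2 (δt • skew vL) ((-(δt ^ 2 / 2)) • (skew vL * R₁)) (skew vL)
      Γl4 Γl5 * NRl = 0 ∧
    row6 Γπ1 A ((-δt) • vecMulVec n n) ((δt ^ 2 / 2) • (vecMulVec n n * R₁))
      (-(vecMulVec n n)) Γπ4 * NRπ = 0 := by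
  have hR : R₁ * R₁ᵀ = 1 := mul_eq_one_comm.mp hR₁.1
  have cancel (X : M3) : R₁ * (R₁ᵀ * X) = X := by rw [← mul_assoc, hR, one_mul]
  intro w₁ w₂ cp Γ₁ Γl1 Γl4 Γl5 Γπ1 Γπ4 NRpt NRl NRπ
  refine ⟨?_, ?_, ?_⟩
  · simp only [NRpt, Γ₁, row6_mul_stack6, mul_assoc, hR, cancel, skew_add, skew_sub, skew_smul,
      mul_neg, neg_mul, smul_mul_assoc, mul_one, one_mul, mul_zero]
    module
  · simp only [NRl, Γl1, Γl4, row6v_mul_stack7, mul_assoc, hR, cancel, skew_mulVec, mul_neg,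
      smul_mul_assoc, mul_one, mul_zero, vecMulVec_zero]
    module
  · have swap : vecMulVec n n * skew Pk = -(vecMulVec n Pk * skew n) := by
      rw [vecMulVec_mul, vecMulVec_mul, vecMul_skew_swap, vecMulVec_neg]
    have self : vecMulVec n n * skew n = 0 := by
      rw [vecMulVec_mul, vecMul_skew_self, vecMulVec_zero]
    have feature : Γπ4 * skew cp =
        (d - n ⬝ᵥ Pk) • skew n - vecMulVec n Pk * skew n := by
      simp only [Γπ4, cp, skew_smul, smul_mul_assoc, mul_smul_comm,
        smul_inv_smul₀ hd, add_mul, sub_mul, one_mul, self, smul_zero, add_zero]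
    simp only [NRπ, Γπ1, row6_mul_stack6, mul_assoc, hR, cancel, skew_add, skew_sub, skew_smul,
      mul_add, mul_sub, mul_neg, neg_mul, smul_mul_assoc, mul_smul_comm, mul_one, mul_zero,
      feature, swap]
    module
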